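/- (Fidelity-based Schmidt number witness.) Let d ≥ 1 and let μ be a natural number. Suppose ρ = Σ_{i ∈ I} p_i · ψ_i (ψ_i)ᴴ is a finite convex combination (p_i ≥ 0, Σ p_i = 1) of rank-one projections onto unit vectors ψ_i ∈ ℂ^(Fin d × Fin d), each of Schmidt rank ≤ μ. Then Re(trace(ρ * P)) ≤ μ/d, where P = φ⁺ (φ⁺)ᴴ; equivalently, Re(trace(ρ * ((μ/d) • 1 − P))) ≥ 0. -/

import Mathlib

open Matrix
open scoped Kronecker

/-- The maximally entangled vector `φ⁺`, with components `φ⁺_{(j,k)} = δ_{jk}/√d`. -/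
noncomputable def phiPlus (d : ℕ) : Fin d × Fin d → ℂ :=
  fun p => if p.1 = p.2 then ((Real.sqrt d : ℝ) : ℂ)⁻¹ else 0

/-- The projection `P = φ⁺ (φ⁺)ᴴ` onto the maximally entangled vector. -/
noncomputable def mesProj (d : ℕ) : Matrix (Fin d × Fin d) (Fin d × Fin d) ℂ :=
  Matrix.vecMulVec (phiPlus d) (star (phiPlus d))

open scoped InnerProductSpace

/-- The squared modulus of the trace is at most the rank times the squared Frobenius norm. -/
theorem sq_norm_trace_le_rank_mul {n : Type*} [Fintype n] [DecidableEq n] (C : Matrix n n ℂ) :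
    ‖C.trace‖ ^ 2 ≤ (C.rank : ℝ) * ∑ x : n × n, ‖C x.1 x.2‖ ^ 2 := by
  let W : Submodule ℂ (EuclideanSpace ℂ n) := LinearMap.range (Matrix.toEuclideanLin C)
  let b := stdOrthonormalBasis ℂ W
  have hW : Module.finrank ℂ W = C.rank :=
    (Matrix.rank_eq_finrank_range_toLin C (EuclideanSpace.basisFun n ℂ).toBasis
      (EuclideanSpace.basisFun n ℂ).toBasis).symm
  let c : n → W := fun k =>
    ⟨Matrix.toEuclideanLin C (EuclideanSpace.single k 1), LinearMap.mem_range_self _ _⟩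
  have hc : ∀ j k, (c k : EuclideanSpace ℂ n) j = C j k := fun j k => by
    simp [c, Matrix.toLpLin_apply]
  have htr : C.trace = ∑ x : n × Fin (Module.finrank ℂ W),
      ⟪b x.2, c x.1⟫_ℂ * (b x.2 : EuclideanSpace ℂ n) x.1 := by
    rw [Fintype.sum_prod_type, Matrix.trace]
    refine Finset.sum_congr rfl fun k _ => ?_
    have h := congrArg (fun w : W => (w : EuclideanSpace ℂ n) k) (b.sum_repr' (c k))
    simp only [hc] at h
    rw [Matrix.diag_apply, ← h]
    simp
  have hcoeff : ∑ x : n × Fin (Module.finrank ℂ W), ‖⟪b x.2, c x.1⟫_ℂ‖ ^ 2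
      = ∑ x : n × n, ‖C x.1 x.2‖ ^ 2 := by
    rw [Fintype.sum_prod_type, Fintype.sum_prod_type_right]
    refine Finset.sum_congr rfl fun k _ => ?_
    refine (b.sum_sq_norm_inner_right (c k)).trans ?_
    rw [← Submodule.norm_coe, EuclideanSpace.norm_sq_eq]
    simp only [hc]
  have hbasis : ∑ x : n × Fin (Module.finrank ℂ W), ‖(b x.2 : EuclideanSpace ℂ n) x.1‖ ^ 2
      = (C.rank : ℝ) := by
    rw [Fintype.sum_prod_type_right, ← hW]
    simp only [← EuclideanSpace.norm_sq_eq, Submodule.norm_coe, b.norm_eq_one]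
    simp
  calc ‖C.trace‖ ^ 2
      ≤ (∑ x : n × Fin (Module.finrank ℂ W),
          ‖⟪b x.2, c x.1⟫_ℂ‖ * ‖(b x.2 : EuclideanSpace ℂ n) x.1‖) ^ 2 := by
        rw [htr]
        gcongr
        exact (norm_sum_le _ _).trans_eq (by simp only [norm_mul])
    _ ≤ _ := Finset.sum_mul_sq_le_sq_mul_sq _ _ _
    _ = _ := by rw [hcoeff, hbasis, mul_comm]

theorem trace_vecMulVec_mul_vecMulVec_star {n : Type*} [Fintype n] (u v : n → ℂ) :
    (vecMulVec u (star u) * vecMulVec v (star v)).trace = ((‖star v ⬝ᵥ u‖ ^ 2 : ℝ) : ℂ) := by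
  rw [vecMulVec_mul_vecMulVec, trace_vecMulVec, dotProduct_smul, dotProduct_comm u,
    smul_eq_mul, Matrix.star_dotProduct u v, Complex.ofReal_pow, ← Complex.conj_mul',
    starRingEnd_apply]

theorem star_phiPlus_dotProduct (d : ℕ) (u : Fin d × Fin d → ℂ) :
    star (phiPlus d) ⬝ᵥ u
      = ((Real.sqrt d : ℝ) : ℂ)⁻¹ * (Matrix.of fun j k : Fin d => u (j, k)).trace := by
  simp [dotProduct, phiPlus, Fintype.sum_prod_type, Matrix.trace, Finset.mul_sum,
    apply_ite (starRingEnd ℂ)]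

/-- The fidelity of a unit vector of Schmidt rank at most `μ` with `φ⁺` is at most `μ / d`. -/
theorem sq_norm_star_phiPlus_dotProduct_le {d μ : ℕ} (u : Fin d × Fin d → ℂ)
    (hu : ∑ x, ‖u x‖ ^ 2 = 1) (hrank : (Matrix.of fun j k : Fin d => u (j, k)).rank ≤ μ) :
    ‖star (phiPlus d) ⬝ᵥ u‖ ^ 2 ≤ (μ : ℝ) / d := by
  have h := sq_norm_trace_le_rank_mul (Matrix.of fun j k : Fin d => u (j, k))
  simp only [Matrix.of_apply, Prod.mk.eta, hu, mul_one] at h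
  have hμ := h.trans (Nat.cast_le.mpr hrank)
  rw [star_phiPlus_dotProduct, norm_mul, mul_pow, norm_inv, Complex.norm_real, inv_pow,
    Real.norm_eq_abs, sq_abs, Real.sq_sqrt (Nat.cast_nonneg d), div_eq_inv_mul]
  gcongr

/-- Fidelity-based Schmidt number witness: if `ρ` is a finite convex combination of rank-one
projections onto unit vectors of Schmidt rank at most `μ`, then
`Re(trace(ρ * P)) ≤ μ/d`; equivalently `Re(trace(ρ * ((μ/d) • 1 − P))) ≥ 0`. -/
theorem re_trace_mesProj_le_of_schmidt_rank_le (d μ : ℕ) (hd : 1 ≤ d)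
    {I : Type} [Fintype I] (p : I → ℝ) (ψ : I → Fin d × Fin d → ℂ)
    (hp : ∀ i, 0 ≤ p i) (hpsum : ∑ i, p i = 1)
    (hunit : ∀ i, ∑ x : Fin d × Fin d, ‖ψ i x‖ ^ 2 = 1)
    (hrank : ∀ i, (Matrix.of fun j k : Fin d => ψ i (j, k)).rank ≤ μ)
    (ρ : Matrix (Fin d × Fin d) (Fin d × Fin d) ℂ)
    (hρ : ρ = ∑ i, (p i : ℂ) • Matrix.vecMulVec (ψ i) (star (ψ i))) :
    (Matrix.trace (ρ * mesProj d)).re ≤ (μ : ℝ) / d ∧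
      0 ≤ (Matrix.trace (ρ * (((μ : ℂ) / d) • (1 : Matrix (Fin d × Fin d) (Fin d × Fin d) ℂ)
        - mesProj d))).re := by
  have hle : (Matrix.trace (ρ * mesProj d)).re ≤ (μ : ℝ) / d := by
    have htr : (Matrix.trace (ρ * mesProj d)).re
        = ∑ i, p i * ‖star (phiPlus d) ⬝ᵥ ψ i‖ ^ 2 := by
      simp only [hρ, mesProj, Finset.sum_mul, Matrix.trace_sum, Matrix.smul_mul,
        Matrix.trace_smul, trace_vecMulVec_mul_vecMulVec_star, smul_eq_mul, ← Complex.ofReal_mul,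
        Complex.re_sum, Complex.ofReal_re]
    calc (Matrix.trace (ρ * mesProj d)).re
        = ∑ i, p i * ‖star (phiPlus d) ⬝ᵥ ψ i‖ ^ 2 := htr
      _ ≤ ∑ i, p i * ((μ : ℝ) / d) := by
        gcongr with i
        · exact hp i
        · exact sq_norm_star_phiPlus_dotProduct_le (ψ i) (hunit i) (hrank i)
      _ = (μ : ℝ) / d := by rw [← Finset.sum_mul, hpsum, one_mul]
  refine ⟨hle, ?_⟩
  have hψ : ∀ i, (vecMulVec (ψ i) (star (ψ i))).trace = 1 := fun i => by
    rw [trace_vecMulVec, dotProduct]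
    simp only [Pi.star_apply, RCLike.star_def, Complex.mul_conj']
    exact_mod_cast hunit i
  have hρ1 : ρ.trace = 1 := by
    simp only [hρ, Matrix.trace_sum, Matrix.trace_smul, hψ, smul_eq_mul, mul_one]
    exact_mod_cast hpsum
  rw [Matrix.mul_sub, Matrix.mul_smul, Matrix.mul_one, Matrix.trace_sub, Matrix.trace_smul, hρ1,
    smul_eq_mul, mul_one, Complex.sub_re, sub_nonneg]
  convert hle using 1
  rw [← Complex.ofReal_natCast, ← Complex.ofReal_natCast, ← Complex.ofReal_div,
    Complex.ofReal_re]
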